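/- Let P₁ and P₂ be finite semipure posets of the same length, and assume P₂ has a minimum element 0̂₂. Let λ₁ : Cov(P̂₁) → L₁ be an EL-labeling of P̂₁ and let λ₂ : Cov(P₂) → L₂ be a semi-EL-labeling of P₂. Let 0̂₁ denote the minimum and 1̂₁ the maximum of P̂₁, identify the adjoined minimum of the bounded poset (P₁∗P₂)^ with (0̂₁,0̂₂), and let 1̂ denote its adjoined maximum. Let L be the poset L₁ × (L₂ ⊎ {0̂_{L₂}}), the product order in which a new minimum element 0̂_{L₂} has been adjoined to L₂. Define λ : Cov((P₁∗P₂)^) → L by λ((x,k),(y,l)) = (λ₁(x,y), λ₂(k,l)) if k <_{P₂} l, λ((x,k),(y,l)) = (λ₁(x,y), 0̂_{L₂}) if k = l (for (y,l) ≠ 1̂), and λ((x,k),1̂) = (λ₁(x,1̂₁), 0̂_{L₂}). Then λ is an EL-labeling of (P₁∗P₂)^. -/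

import Mathlib

/-!
Statement 0: The Rees product edge labeling built from an EL-labeling of `P̂₁` and a
semi-EL-labeling of `P₂` is an EL-labeling of `(P₁ ∗ P₂)^`.
-/

attribute [local instance] Classical.propDecidable

section Prelude

variable {α : Type*} {L : Type*}

/-- The cover relation within the subposet on the subset `s`. -/
def CovIn [PartialOrder α] (s : Set α) (a b : α) : Prop :=
  a ∈ s ∧ b ∈ s ∧ a < b ∧ ∀ c ∈ s, ¬(a < c ∧ c < b)

/-- `l` is a maximal chain of the subposet of `α` on the subset `s`:
a nonempty saturated chain starting at a minimal element of `s` and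
ending at a maximal element of `s`. -/
def IsMaxChainIn [PartialOrder α] (s : Set α) (l : List α) : Prop :=
  l ≠ [] ∧ (∀ x ∈ l, x ∈ s) ∧ l.Chain' (CovIn s) ∧
    (∀ x, l.head? = some x → ∀ c ∈ s, ¬c < x) ∧
    (∀ x, l.getLast? = some x → ∀ c ∈ s, ¬x < c)

/-- `l` is a maximal chain of the poset `α`. -/
def IsMaximalChain [PartialOrder α] (l : List α) : Prop :=
  IsMaxChainIn Set.univ l

/-- The poset `α` has length `n`, i.e. its longest chains have `n + 1` elements. -/
def HasLength (α : Type*) [PartialOrder α] (n : ℕ) : Prop :=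
  (∃ l : List α, l.Chain' (· < ·) ∧ l.length = n + 1) ∧
    ∀ l : List α, l.Chain' (· < ·) → l.length ≤ n + 1

/-- `r` is a rank function for the poset `α`; the existence of such a function says
exactly that `α` is semipure with rank function `r` (for every `x`, every maximal chain
of the lower order ideal `P_{≤ x}` has length `r x`, i.e. `r x + 1` elements). -/
def IsRankFunction [PartialOrder α] (r : α → ℕ) : Prop :=
  ∀ x : α, ∀ l : List α, IsMaxChainIn (Set.Iic x) l → l.length = r x + 1

/-- The label sequence of a chain `l` under the edge labeling `lab`. -/
def labelSeq (lab : α → α → L) (l : List α) : List L :=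
  List.zipWith lab l l.tail

/-- `l` is a maximal (i.e. saturated) chain of the closed interval `[x, y]`. -/
def IsMaxChainOfInterval [PartialOrder α] (x y : α) (l : List α) : Prop :=
  l.Chain' (· ⋖ ·) ∧ l.head? = some x ∧ l.getLast? = some y

/-- The EL-condition for the interval `[x, y]`: there is a unique maximal chain of
`[x, y]` with weakly increasing labels, and its label sequence strictly lexicographically
precedes the label sequence of any other maximal chain of `[x, y]`. -/
def ELCondition [PartialOrder α] [PartialOrder L] (lab : α → α → L) (x y : α) : Prop :=
  ∃ c : List α, IsMaxChainOfInterval x y c ∧ (labelSeq lab c).Chain' (· ≤ ·) ∧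
    (∀ d : List α, IsMaxChainOfInterval x y d → (labelSeq lab d).Chain' (· ≤ ·) → d = c) ∧
    ∀ d : List α, IsMaxChainOfInterval x y d → d ≠ c →
      List.Lex (· < ·) (labelSeq lab c) (labelSeq lab d)

/-- `lab` is an EL-labeling of the poset `α`. -/
def IsELLabeling [PartialOrder α] [PartialOrder L] (lab : α → α → L) : Prop :=
  ∀ x y : α, x ≤ y → ELCondition lab x y

/-- `lab` is a semi-EL-labeling of the poset `α` with minimum element: its restriction to
`[⊥, m]` is an EL-labeling for every maximal element `m`. -/
def IsSemiELLabeling [PartialOrder α] [OrderBot α] [PartialOrder L] (lab : α → α → L) : Prop :=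
  ∀ m : α, IsMax m → ∀ x y : α, x ≤ y → y ≤ m → ELCondition lab x y

/-- The underlying set of the Rees product of two (semipure) posets with
rank functions `rP`, `rQ`. -/
def Rees {α β : Type*} [PartialOrder α] [PartialOrder β] (rP : α → ℕ) (rQ : β → ℕ) : Type _ :=
  {x : α × β // rQ x.2 ≤ rP x.1}

/-- The Rees product order: `(p₁,q₁) ≤ (p₂,q₂)` iff `p₁ ≤ p₂`, `q₁ ≤ q₂` and the rank
increase in the first coordinate is at least the rank increase in the second coordinate. -/
instance Rees.instPartialOrder {α β : Type*} [PartialOrder α] [PartialOrder β]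
    (rP : α → ℕ) (rQ : β → ℕ) : PartialOrder (Rees rP rQ) where
  le x y := x.1.1 ≤ y.1.1 ∧ x.1.2 ≤ y.1.2 ∧ rQ y.1.2 + rP x.1.1 ≤ rP y.1.1 + rQ x.1.2
  le_refl x := ⟨le_rfl, le_rfl, by omega⟩
  le_trans x y z h₁ h₂ := ⟨h₁.1.trans h₂.1, h₁.2.1.trans h₂.2.1, by
    have := h₁.2.2; have := h₂.2.2; omega⟩
  le_antisymm x y h₁ h₂ := Subtype.ext
    (Prod.ext (le_antisymm h₁.1 h₂.1) (le_antisymm h₁.2.1 h₂.2.1))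

/-- First (`P₁`) component of an element of `(P₁ ∗ P₂)^`, as an element of `P̂₁`;
the adjoined minimum goes to `0̂₁` and the adjoined maximum to `1̂₁`. -/
def reesFst {α β : Type*} [PartialOrder α] [PartialOrder β] {rP : α → ℕ} {rQ : β → ℕ}
    (a : WithBot (WithTop (Rees rP rQ))) : WithBot (WithTop α) :=
  WithBot.recBotCoe ⊥
    (fun b => WithTop.recTopCoe (⊤ : WithBot (WithTop α))
      (fun z => ((z.1.1 : WithTop α) : WithBot (WithTop α))) b) a

/-- Second (`P₂`) component of an element of `(P₁ ∗ P₂)^`; the adjoined minimum is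
identified with `(0̂₁, 0̂₂)`, so its second component is `0̂₂ = ⊥`. -/
def reesSnd {α β : Type*} [PartialOrder α] [PartialOrder β] [OrderBot β]
    {rP : α → ℕ} {rQ : β → ℕ} (a : WithBot (WithTop (Rees rP rQ))) : β :=
  WithBot.recBotCoe ⊥ (fun b => WithTop.recTopCoe (⊥ : β) (fun z => z.1.2) b) a

/-- The Rees-product edge labeling of `(P₁ ∗ P₂)^` by the poset `L₁ × (L₂ ⊎ {0̂_{L₂}})`
(the product order, a new minimum `⊥` adjoined to `L₂`): a cover `((x,k),(y,l))` is
labeled `(λ₁(x,y), λ₂(k,l))` if `k < l`, and `(λ₁(x,y), 0̂_{L₂})` if `k = l`; a cover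
`((x,k), 1̂)` of the top is labeled `(λ₁(x,1̂₁), 0̂_{L₂})`. -/
noncomputable def reesLab {α β L₁ L₂ : Type*} [PartialOrder α] [PartialOrder β] [OrderBot β]
    [PartialOrder L₂] (rP : α → ℕ) (rQ : β → ℕ)
    (lab₁ : WithBot (WithTop α) → WithBot (WithTop α) → L₁) (lab₂ : β → β → L₂)
    (a b : WithBot (WithTop (Rees rP rQ))) : L₁ × WithBot L₂ :=
  (lab₁ (reesFst a) (reesFst b),
    if reesSnd a < reesSnd b then ((lab₂ (reesSnd a) (reesSnd b) : L₂) : WithBot L₂) else ⊥)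

end Prelude

section ReesProof

set_option linter.unusedSectionVars false
set_option linter.unusedSimpArgs false

/-- a saturated path for a relation -/
def RPath {α : Type*} (R : α → α → Prop) (x y : α) (l : List α) : Prop :=
  l.IsChain R ∧ l.head? = some x ∧ l.getLast? = some y

theorem rpath_cases {α : Type*} {R : α → α → Prop} {x y : α} {l : List α} (h : RPath R x y l) :
    (l = [x] ∧ x = y) ∨ ∃ z t, l = x :: z :: t ∧ R x z ∧ RPath R z y (z :: t) := by
  obtain ⟨h1, h2, h3⟩ := h
  match l, h1, h2, h3 with
  | [a], h1, h2, h3 => left; simp_all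
  | a :: b :: t, h1, h2, h3 =>
    right
    simp only [List.head?_cons, Option.some.injEq] at h2
    subst h2
    rw [List.isChain_cons_cons] at h1
    exact ⟨b, t, rfl, h1.1, h1.2, rfl, by simpa using h3⟩

theorem rpath_single {α : Type*} {R : α → α → Prop} (x : α) : RPath R x x [x] := by
  simp [RPath]

theorem rpath_cons {α : Type*} {R : α → α → Prop} {x z y : α} {l : List α} (h : R x z)
    (hl : RPath R z y l) : RPath R x y (x :: l) := by
  obtain ⟨h1, h2, h3⟩ := hl
  match l, h1, h2, h3 with
  | b :: t, h1, h2, h3 =>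
    simp only [List.head?_cons, Option.some.injEq] at h2
    subst h2
    refine ⟨List.isChain_cons_cons.2 ⟨h, h1⟩, rfl, by simpa using h3⟩

theorem rpath_head {α : Type*} {R : α → α → Prop} {x y : α} {l : List α} (h : RPath R x y l) :
    ∃ t, l = x :: t := by
  rcases rpath_cases h with ⟨h, _⟩ | ⟨z, t, h, _⟩
  · exact ⟨_, h⟩
  · exact ⟨_, h⟩

/-- induction principle for paths -/
theorem rpath_ind {α : Type*} {R : α → α → Prop} {y : α} (M : α → List α → Prop)
    (h0 : M y [y])
    (h1 : ∀ x z t, R x z → RPath R z y (z :: t) → M z (z :: t) → M x (x :: z :: t)) :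
    ∀ (l : List α) (x : α), RPath R x y l → M x l := by
  intro l
  induction l with
  | nil => intro x h; simp [RPath] at h
  | cons a t ih =>
    intro x h
    rcases rpath_cases h with ⟨h', rfl⟩ | ⟨z, t', h, hR, hp⟩
    · rw [h']; exact h0
    · obtain ⟨rfl, rfl⟩ := List.cons.inj h
      exact h1 _ _ _ hR hp (ih _ hp)

theorem labelSeq_cons {α L : Type*} (lab : α → α → L) (x z : α) (t : List α) :
    labelSeq lab (x :: z :: t) = lab x z :: labelSeq lab (z :: t) := rfl

theorem labelSeq_single {α L : Type*} (lab : α → α → L) (x : α) :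
    labelSeq lab [x] = [] := rfl

theorem labelSeq_length {α L : Type*} (lab : α → α → L) (l : List α) :
    (labelSeq lab l).length = l.length - 1 := by
  simp [labelSeq]

theorem el_iff {α L : Type*} [PartialOrder α] [PartialOrder L] (lab : α → α → L) (x y : α) :
    ELCondition lab x y ↔ ∃ c : List α, RPath (· ⋖ ·) x y c ∧ (labelSeq lab c).IsChain (· ≤ ·) ∧
    (∀ d : List α, RPath (· ⋖ ·) x y d → (labelSeq lab d).IsChain (· ≤ ·) → d = c) ∧
    ∀ d : List α, RPath (· ⋖ ·) x y d → d ≠ c →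
      List.Lex (· < ·) (labelSeq lab c) (labelSeq lab d) := Iff.rfl

/-! ### zip lemmas -/

theorem zip_chain {A B : Type*} [PartialOrder A] [PartialOrder B] : ∀ (u : List A) (v : List B),
    u.length = v.length →
    ((List.zip u v).IsChain (· ≤ ·) ↔ u.IsChain (· ≤ ·) ∧ v.IsChain (· ≤ ·))
  | [], [], _ => by simp
  | [a], [b], _ => by simp
  | a :: a' :: u, b :: b' :: v, h => by
    have := zip_chain (a' :: u) (b' :: v) (by simpa using h)
    simp only [List.zip_cons_cons] at this
    simp only [List.zip_cons_cons, List.isChain_cons_cons, this, Prod.mk_le_mk]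
    tauto

theorem zip_lex {A B : Type*} [PartialOrder A] [PartialOrder B] :
    ∀ (u1 v1 : List A) (u2 v2 : List B),
    u1.length = u2.length → v1.length = v2.length →
    (u1 = v1 ∨ List.Lex (· < ·) u1 v1) → (u2 = v2 ∨ List.Lex (· < ·) u2 v2) →
    ¬ (u1 = v1 ∧ u2 = v2) → List.Lex (· < ·) (List.zip u1 u2) (List.zip v1 v2)
  | [], [], [], [], _, _, _, _, h => by simp at h
  | [], b :: v1, [], d :: v2, _, _, _, _, h => by
    simp only [List.zip_cons_cons, List.zip_nil_left]; exact List.Lex.nil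
  | a :: u1, [], _, _, _, _, h1, _, h => by
    rcases h1 with h1 | h1
    · cases h1
    · cases h1
  | a :: u1, b :: v1, c :: u2, d :: v2, e1, e2, h1, h2, h => by
    simp only [List.zip_cons_cons]
    have H1 : a < b ∨ a = b ∧ (u1 = v1 ∨ List.Lex (· < ·) u1 v1) := by
      rcases h1 with h1 | h1
      · right; simp_all
      · cases h1 with
        | rel h => exact Or.inl h
        | cons h => exact Or.inr ⟨rfl, Or.inr h⟩
    have H2 : c < d ∨ c = d ∧ (u2 = v2 ∨ List.Lex (· < ·) u2 v2) := by
      rcases h2 with h1 | h1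
      · right; simp_all
      · cases h1 with
        | rel h => exact Or.inl h
        | cons h => exact Or.inr ⟨rfl, Or.inr h⟩
    rcases H1 with H1 | ⟨rfl, H1⟩
    · apply List.Lex.rel
      rw [Prod.mk_lt_mk]
      left
      refine ⟨H1, ?_⟩
      rcases H2 with H2 | ⟨rfl, H2⟩
      · exact H2.le
      · exact le_rfl
    · rcases H2 with H2 | ⟨rfl, H2⟩
      · apply List.Lex.rel
        rw [Prod.mk_lt_mk]
        right
        exact ⟨le_rfl, H2⟩
      · apply List.Lex.cons
        apply zip_lex u1 v1 u2 v2 (by simpa using e1) (by simpa using e2) H1 H2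
        rintro ⟨rfl, rfl⟩
        exact h ⟨rfl, rfl⟩

theorem zip_lex_bot {A B : Type*} [PartialOrder A] [PartialOrder B] [OrderBot B] :
    ∀ (u1 v1 : List A) (u2 v2 : List B),
    u1.length = u2.length → v1.length = v2.length →
    (u1 = v1 ∨ List.Lex (· < ·) u1 v1) → (∀ b ∈ u2, b = ⊥) →
    ¬ (u1 = v1 ∧ u2 = v2) → List.Lex (· < ·) (List.zip u1 u2) (List.zip v1 v2)
  | [], [], [], [], _, _, _, _, h => by simp at h
  | [], b :: v1, [], d :: v2, _, _, _, _, h => by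
    simp only [List.zip_cons_cons, List.zip_nil_left]; exact List.Lex.nil
  | a :: u1, [], _, _, _, _, h1, _, h => by
    rcases h1 with h1 | h1
    · cases h1
    · cases h1
  | a :: u1, b :: v1, c :: u2, d :: v2, e1, e2, h1, h2, h => by
    simp only [List.zip_cons_cons]
    have H1 : a < b ∨ a = b ∧ (u1 = v1 ∨ List.Lex (· < ·) u1 v1) := by
      rcases h1 with h1 | h1
      · right; simp_all
      · cases h1 with
        | rel h => exact Or.inl h
        | cons h => exact Or.inr ⟨rfl, Or.inr h⟩
    have hc : c = ⊥ := h2 c (by simp)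
    subst hc
    rcases H1 with H1 | ⟨rfl, H1⟩
    · apply List.Lex.rel
      rw [Prod.mk_lt_mk]
      left
      exact ⟨H1, bot_le⟩
    · by_cases hd : d = ⊥
      · subst hd
        apply List.Lex.cons
        apply zip_lex_bot u1 v1 u2 v2 (by simpa using e1) (by simpa using e2) H1
          (fun b hb => h2 b (by simp [hb]))
        rintro ⟨rfl, rfl⟩
        exact h ⟨rfl, rfl⟩
      · apply List.Lex.rel
        rw [Prod.mk_lt_mk]
        right
        exact ⟨le_rfl, bot_lt_iff_ne_bot.2 hd⟩

/-! ### rank functions -/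

theorem maxchain_snoc {α : Type*} [PartialOrder α] {y x : α} (h : y ⋖ x) {l : List α}
    (hl : IsMaxChainIn (Set.Iic y) l) : IsMaxChainIn (Set.Iic x) (l ++ [x]) := by
  obtain ⟨h1, h2, h3, h4, h5⟩ := hl
  have hlast : l.getLast? = some y := by
    have hz := List.getLast?_eq_some_getLast h1
    generalize l.getLast h1 = z at hz
    have hzy : z ≤ y := h2 z (List.mem_of_getLast? hz)
    rcases hzy.eq_or_lt with rfl | hlt
    · exact hz
    · exact absurd hlt (h5 z hz y (le_refl y))
  refine ⟨by simp, ?_, ?_, ?_, ?_⟩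
  · intro z hz
    rcases List.mem_append.1 hz with hz | hz
    · exact le_trans (h2 z hz) h.le
    · simp at hz; subst hz; exact le_refl _
  · refine List.isChain_append.2 ⟨?_, by simp, ?_⟩
    · refine List.IsChain.imp ?_ h3
      rintro a b ⟨ha, hb, hab, hc⟩
      refine ⟨le_trans ha h.le, le_trans hb h.le, hab, ?_⟩
      rintro c - ⟨h6, h7⟩
      exact hc c (le_trans h7.le hb) ⟨h6, h7⟩
    · intro a ha b hb
      rw [hlast] at ha
      simp at ha hb
      subst ha; subst hb
      exact ⟨h.le, le_refl _, h.lt, fun c _ hc => h.2 hc.1 hc.2⟩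
  · intro z hz c hc hcz
    have : l.head? = some z := by
      cases l with
      | nil => simp at h1
      | cons a t => simpa using hz
    have hzy : z ≤ y := h2 z (List.mem_of_head? this)
    exact h4 z this c (hcz.le.trans hzy) hcz
  · intro z hz c hc hcz
    simp at hz
    subst hz
    exact absurd hcz (not_lt_of_ge hc)

theorem maxchain_min {α : Type*} [PartialOrder α] {x : α} (h : ∀ y, ¬ y < x) :
    IsMaxChainIn (Set.Iic x) [x] := by
  refine ⟨by simp, by simp, List.isChain_singleton _, ?_, ?_⟩
  · simpa using fun c _ => h c
  · rintro z hz c hc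
    simp at hz
    subst hz
    exact not_lt_of_ge hc

theorem maxchain_exists {α : Type*} [PartialOrder α] [Finite α] (x : α) :
    ∃ l, IsMaxChainIn (Set.Iic x) l := by
  induction x using WellFoundedLT.induction with
  | _ x ih =>
    by_cases h : ∃ y, y < x
    · obtain ⟨y, hy⟩ := h
      obtain ⟨z, -, hz⟩ := exists_le_covBy_of_lt hy
      obtain ⟨l, hl⟩ := ih z hz.lt
      exact ⟨_, maxchain_snoc hz hl⟩
    · exact ⟨_, maxchain_min (not_exists.1 h)⟩

theorem rank_cov {α : Type*} [PartialOrder α] [Finite α] {r : α → ℕ} (hr : IsRankFunction r)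
    {x y : α} (h : x ⋖ y) : r y = r x + 1 := by
  obtain ⟨l, hl⟩ := maxchain_exists x
  have h1 := hr x l hl
  have h2 := hr y _ (maxchain_snoc h hl)
  simp at h2
  omega

theorem rank_min {α : Type*} [PartialOrder α] {r : α → ℕ} (hr : IsRankFunction r)
    {x : α} (h : ∀ y, ¬ y < x) : r x = 0 := by
  have := hr x _ (maxchain_min h)
  simpa using this

theorem rank_mono {α : Type*} [PartialOrder α] [Finite α] {r : α → ℕ} (hr : IsRankFunction r)
    {x : α} (y : α) : x ≤ y → r x ≤ r y := by
  induction y using WellFoundedLT.induction with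
  | _ y ih =>
    intro h
    rcases h.eq_or_lt with rfl | h
    · rfl
    · obtain ⟨z, hz, hzy⟩ := exists_le_covBy_of_lt h
      have := ih z hzy.lt hz
      have := rank_cov hr hzy
      omega

theorem rank_lt {α : Type*} [PartialOrder α] [Finite α] {r : α → ℕ} (hr : IsRankFunction r)
    {x y : α} (h : x < y) : r x < r y := by
  obtain ⟨z, hz, hzy⟩ := exists_le_covBy_of_lt h
  have := rank_mono hr _ hz
  have := rank_cov hr hzy
  omega

/-! ### weak chains in the second factor -/

/-- equal or covered -/
def CovE {β : Type*} [PartialOrder β] (k l : β) : Prop := k = l ∨ k ⋖ l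

/-- label of a weak step -/
noncomputable def labE {β L : Type*} [PartialOrder β] (lab : β → β → L) (k l : β) :
    WithBot L := if k < l then ((lab k l : L) : WithBot L) else ⊥

theorem labE_self {β L : Type*} [PartialOrder β] (lab : β → β → L) (k : β) :
    labE lab k k = ⊥ := by simp [labE]

theorem labE_lt {β L : Type*} [PartialOrder β] (lab : β → β → L) {k l : β} (h : k < l) :
    labE lab k l = (lab k l : L) := by simp [labE, h]

section weak
variable {β L : Type*} [PartialOrder β] {r : β → ℕ}

theorem len_strict (hr : ∀ k l : β, k ⋖ l → r l = r k + 1) {l : β} (C : List β) (k : β)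
    (h : RPath (· ⋖ ·) k l C) : C.length + r k = r l + 1 := by
  revert k C
  apply rpath_ind
  · simp; omega
  · intro x z t h1 _ h2
    have := hr _ _ h1
    simp at h2 ⊢
    omega

theorem len_weak (hr : ∀ k l : β, k ⋖ l → r l = r k + 1) {l : β} (W : List β) (k : β)
    (h : RPath CovE k l W) : r l + 1 ≤ W.length + r k := by
  revert k W
  apply rpath_ind
  · simp
  · intro x z t h1 _ h2
    simp at h2 ⊢
    rcases h1 with rfl | h1
    · omega
    · have := hr _ _ h1
      omega

theorem weak_eq (hr : ∀ k l : β, k ⋖ l → r l = r k + 1) {l : β} (W : List β) (k : β)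
    (h : RPath CovE k l W) : W.length + r k = r l + 1 → RPath (· ⋖ ·) k l W := by
  revert k W
  apply rpath_ind
  · intro _; exact rpath_single _
  · intro x z t h1 hp h2 h3
    have h4 := len_weak hr _ _ hp
    simp at h2 h3 h4
    rcases h1 with rfl | h1
    · omega
    · have := hr _ _ h1
      exact rpath_cons h1 (h2 (by omega))

theorem seq_strict (lab : β → β → L) {l : β} (W : List β) (k : β)
    (h : RPath (· ⋖ ·) k l W) :
    labelSeq (labE lab) W = (labelSeq lab W).map (WithBot.some : L → WithBot L) := by
  revert k W
  apply rpath_ind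
  · rfl
  · intro x z t h1 hp h2
    rw [labelSeq_cons, labelSeq_cons, h2, labE_lt _ h1.lt]
    rfl

theorem strict_of_incr [PartialOrder L] (lab : β → β → L) {l : β} (W : List β) (k : β)
    (h : RPath CovE k l W) : ∀ b : WithBot L, b ≠ ⊥ →
      (b :: labelSeq (labE lab) W).IsChain (· ≤ ·) → RPath (· ⋖ ·) k l W := by
  revert k W
  apply rpath_ind
  · intro _ _ _; exact rpath_single _
  · intro x z t h1 hp h2 b hb hc
    rw [labelSeq_cons, List.isChain_cons_cons] at hc
    have hne : labE lab x z ≠ ⊥ := fun h => hb (le_bot_iff.1 (h ▸ hc.1))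
    rcases h1 with rfl | h1
    · exact absurd (labE_self _ _) hne
    · exact rpath_cons h1 (h2 _ hne hc.2)

theorem map_lex [PartialOrder L] : ∀ {u v : List L}, List.Lex (· < ·) u v →
    List.Lex (· < ·) (u.map (WithBot.some : L → WithBot L)) (v.map (WithBot.some : L → WithBot L))
  | _, _, List.Lex.nil => List.Lex.nil
  | _, _, List.Lex.rel h => List.Lex.rel (WithBot.coe_lt_coe.2 h)
  | _, _, List.Lex.cons h => List.Lex.cons (map_lex h)

theorem map_chain [PartialOrder L] (u : List L) :
    (u.map (WithBot.some : L → WithBot L)).IsChain (· ≤ ·) ↔ u.IsChain (· ≤ ·) := by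
  rw [List.isChain_map]
  simp only [WithBot.coe_le_coe]

theorem canon_succ (lab : β → β → L) {k l : β} {C : List β} {R : β → β → Prop}
    (hC : RPath R k l C) (n : ℕ) :
    labelSeq (labE lab) (List.replicate (n + 1) k ++ C) =
      ⊥ :: labelSeq (labE lab) (List.replicate n k ++ C) := by
  obtain ⟨t, rfl⟩ := rpath_head hC
  cases n with
  | zero => simp [labelSeq_cons, labE_self]
  | succ n => simp [List.replicate_succ, labelSeq_cons, labE_self]

theorem canon_incr [PartialOrder L] (lab : β → β → L) {k l : β} {C : List β}
    (hC : RPath (· ⋖ ·) k l C) (hi : (labelSeq lab C).IsChain (· ≤ ·)) (n : ℕ) :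
    (labelSeq (labE lab) (List.replicate n k ++ C)).IsChain (· ≤ ·) := by
  induction n with
  | zero =>
    simp only [List.replicate_zero, List.nil_append]
    rw [seq_strict _ _ _ hC, map_chain]
    exact hi
  | succ n ih =>
    rw [canon_succ lab hC]
    generalize labelSeq (labE lab) (List.replicate n k ++ C) = s at ih
    cases s with
    | nil => simp
    | cons a s => exact List.isChain_cons_cons.2 ⟨bot_le, ih⟩

theorem weak_unique [PartialOrder L] (hr : ∀ k l : β, k ⋖ l → r l = r k + 1)
    (lab : β → β → L) {k₀ l : β}
    {C : List β} (hC : RPath (· ⋖ ·) k₀ l C)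
    (hu : ∀ d : List β, RPath (· ⋖ ·) k₀ l d → (labelSeq lab d).IsChain (· ≤ ·) → d = C)
    (W : List β) (k : β) (h : RPath CovE k l W) : k = k₀ →
    (labelSeq (labE lab) W).IsChain (· ≤ ·) →
    W = List.replicate (W.length - C.length) k₀ ++ C := by
  have key : ∀ W, RPath CovE k₀ l W → W.length = C.length →
      (labelSeq (labE lab) W).IsChain (· ≤ ·) →
      W = List.replicate (W.length - C.length) k₀ ++ C := by
    intro W h hl hi
    have h' := weak_eq hr _ _ h (by rw [hl]; exact len_strict hr _ _ hC)
    rw [hl, Nat.sub_self]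
    apply hu _ h'
    rwa [seq_strict _ _ _ h', map_chain] at hi
  have hCl := len_strict hr _ _ hC
  revert k W
  apply rpath_ind
  · rintro rfl hi
    apply key _ (rpath_single _) _ hi
    simp; omega
  · rintro x z t h1 hp ih rfl hi
    by_cases hl : (x :: z :: t).length = C.length
    · exact key _ (rpath_cons h1 hp) hl hi
    · have h3 := len_weak hr _ _ (rpath_cons h1 hp)
      rw [labelSeq_cons] at hi
      rcases h1 with rfl | h1
      · have hi2 : (labelSeq (labE lab) (x :: t)).IsChain (· ≤ ·) := hi.tail
        have := ih rfl hi2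
        have h4 : (x :: x :: t).length - C.length = ((x :: t).length - C.length) + 1 := by
          simp at h3 hl ⊢; omega
        rw [h4, List.replicate_succ, List.cons_append, ← this]
      · exfalso
        have h5 := strict_of_incr lab _ _ hp (labE lab x z) (by simp [labE_lt _ h1.lt]) hi
        have h6 := len_strict hr _ _ (rpath_cons h1 h5)
        omega

theorem weak_lex [PartialOrder L] (hr : ∀ k l : β, k ⋖ l → r l = r k + 1)
    (lab : β → β → L) {k₀ l : β}
    {C : List β} (hC : RPath (· ⋖ ·) k₀ l C)
    (hu : ∀ d : List β, RPath (· ⋖ ·) k₀ l d → d ≠ C →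
      List.Lex (· < ·) (labelSeq lab C) (labelSeq lab d))
    (W : List β) (k : β) (h : RPath CovE k l W) : k = k₀ →
    W = List.replicate (W.length - C.length) k₀ ++ C ∨
    List.Lex (· < ·) (labelSeq (labE lab) (List.replicate (W.length - C.length) k₀ ++ C))
      (labelSeq (labE lab) W) := by
  have key : ∀ W, RPath CovE k₀ l W → W.length = C.length →
      (W = List.replicate (W.length - C.length) k₀ ++ C ∨
      List.Lex (· < ·) (labelSeq (labE lab) (List.replicate (W.length - C.length) k₀ ++ C))
      (labelSeq (labE lab) W)) := by
    intro W h hl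
    have h' := weak_eq hr _ _ h (by rw [hl]; exact len_strict hr _ _ hC)
    rw [hl, Nat.sub_self]
    by_cases hW : W = C
    · left; simpa using hW
    · right
      simp only [List.replicate_zero, List.nil_append]
      rw [seq_strict _ _ _ h', seq_strict _ _ _ hC]
      exact map_lex (hu _ h' hW)
  have hCl := len_strict hr _ _ hC
  revert k W
  apply rpath_ind
  · rintro rfl
    apply key _ (rpath_single _) _
    simp; omega
  · rintro x z t h1 hp ih rfl
    by_cases hl : (x :: z :: t).length = C.length
    · exact key _ (rpath_cons h1 hp) hl
    · have h3 := len_weak hr _ _ (rpath_cons h1 hp)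
      have h4 : (x :: z :: t).length - C.length = ((z :: t).length - C.length) + 1 := by
        simp at h3 hl ⊢; omega
      rw [h4, canon_succ lab hC]
      rcases h1 with rfl | h1
      · rcases ih rfl with h | h
        · left
          rw [List.replicate_succ, List.cons_append, ← h]
        · right
          rw [labelSeq_cons, labE_self]
          exact List.Lex.cons h
      · right
        rw [labelSeq_cons, labE_lt _ h1.lt]
        exact List.Lex.rel (WithBot.bot_lt_coe _)

end weak



/-! ### the structure of the bounded Rees product -/

theorem hat_cases {X : Type*} (a : WithBot (WithTop X)) :
    a = ⊥ ∨ a = ((⊤ : WithTop X) : WithBot (WithTop X)) ∨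
      ∃ x : X, a = ((x : WithTop X) : WithBot (WithTop X)) := by
  induction a using WithBot.recBotCoe with
  | bot => exact Or.inl rfl
  | coe a =>
    induction a using WithTop.recTopCoe with
    | top => exact Or.inr (Or.inl rfl)
    | coe a => exact Or.inr (Or.inr ⟨a, rfl⟩)

theorem hat_top {X : Type*} [PartialOrder X] :
    ((⊤ : WithTop X) : WithBot (WithTop X)) = ⊤ := rfl

/-- shifted rank on the bounded extension (junk at the top) -/
def rho {α : Type*} (rP : α → ℕ) (a : WithBot (WithTop α)) : ℕ :=
  WithBot.recBotCoe 0 (fun b => WithTop.recTopCoe 0 (fun z => rP z + 1) b) a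

section structureOfRees
variable {α β : Type*} [PartialOrder α] [PartialOrder β] [OrderBot β] {rP : α → ℕ} {rQ : β → ℕ}

theorem rho_bot : rho rP ⊥ = 0 := rfl
theorem rho_coe (a : α) : rho rP ((a : WithTop α) : WithBot (WithTop α)) = rP a + 1 := rfl

theorem fst_bot : reesFst (⊥ : WithBot (WithTop (Rees rP rQ))) = ⊥ := rfl
theorem fst_top : reesFst (⊤ : WithBot (WithTop (Rees rP rQ))) = ⊤ := rfl
theorem fst_coe (z : Rees rP rQ) :
    reesFst ((z : WithTop (Rees rP rQ)) : WithBot (WithTop (Rees rP rQ))) =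
      ((z.1.1 : WithTop α) : WithBot (WithTop α)) := rfl
theorem snd_bot : reesSnd (⊥ : WithBot (WithTop (Rees rP rQ))) = ⊥ := rfl
theorem snd_top : reesSnd (⊤ : WithBot (WithTop (Rees rP rQ))) = ⊥ := rfl
theorem snd_coe (z : Rees rP rQ) :
    reesSnd ((z : WithTop (Rees rP rQ)) : WithBot (WithTop (Rees rP rQ))) = z.1.2 := rfl

theorem coe_ne_top' {X : Type*} [PartialOrder X] (x : X) :
    ((x : WithTop X) : WithBot (WithTop X)) ≠ ⊤ := by
  rw [← hat_top]
  simp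

theorem bot_ne_top' {X : Type*} [PartialOrder X] : (⊥ : WithBot (WithTop X)) ≠ ⊤ := by
  rw [← hat_top]
  simp

theorem fst_eq_top {a : WithBot (WithTop (Rees rP rQ))} : reesFst a = ⊤ ↔ a = ⊤ := by
  rcases hat_cases a with rfl | rfl | ⟨z, rfl⟩
  · simp [fst_bot, bot_ne_top']
  · simp [hat_top, fst_top]
  · simp [fst_coe, coe_ne_top']

theorem fst_eq_bot {a : WithBot (WithTop (Rees rP rQ))} : reesFst a = ⊥ ↔ a = ⊥ := by
  rcases hat_cases a with rfl | rfl | ⟨z, rfl⟩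
  · simp [fst_bot]
  · simp [hat_top, fst_top, bot_ne_top'.symm]
  · simp [fst_coe]

theorem snd_of_bot {a : WithBot (WithTop (Rees rP rQ))} (h : reesFst a = ⊥) :
    reesSnd a = ⊥ := by
  rw [fst_eq_bot] at h; rw [h]; rfl

theorem member {a : WithBot (WithTop (Rees rP rQ))} (h : a ≠ ⊤) (h' : reesFst a ≠ ⊥) :
    rQ (reesSnd a) + 1 ≤ rho rP (reesFst a) := by
  rcases hat_cases a with rfl | rfl | ⟨z, rfl⟩
  · exact absurd fst_bot h'
  · exact absurd rfl h
  · rw [fst_coe, snd_coe, rho_coe]; have := z.2; omega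

theorem exists_mk {p : WithBot (WithTop α)} {k : β} (h : rQ k + 1 ≤ rho rP p) :
    ∃ a : WithBot (WithTop (Rees rP rQ)), a ≠ ⊤ ∧ reesFst a = p ∧ reesSnd a = k := by
  rcases hat_cases p with rfl | rfl | ⟨z, rfl⟩
  · simp [rho_bot] at h
  · have : rho rP (((⊤ : WithTop α) : WithBot (WithTop α))) = 0 := rfl
    omega
  · rw [rho_coe] at h
    have h' : rQ (z, k).2 ≤ rP (z, k).1 := by simpa using h
    let w : Rees rP rQ := ⟨(z, k), h'⟩
    exact ⟨((w : WithTop (Rees rP rQ)) : WithBot (WithTop (Rees rP rQ))),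
      coe_ne_top' _, rfl, rfl⟩

theorem rees_ext {a b : WithBot (WithTop (Rees rP rQ))} (h1 : reesFst a = reesFst b)
    (h2 : reesSnd a = reesSnd b) : a = b := by
  rcases hat_cases a with rfl | rfl | ⟨z, rfl⟩
  · exact (fst_eq_bot.1 (h1.symm.trans fst_bot)).symm
  · exact (fst_eq_top.1 (h1.symm.trans fst_top)).symm
  · rcases hat_cases b with rfl | rfl | ⟨w, rfl⟩
    · simp [fst_coe, fst_bot] at h1
    · rw [hat_top, fst_top, fst_eq_top] at h1
      exact h1
    · rw [fst_coe, fst_coe] at h1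
      rw [snd_coe, snd_coe] at h2
      congr 2
      apply Subtype.ext
      apply Prod.ext
      · simpa using h1
      · exact h2

theorem rees_le (hbot : rQ ⊥ = 0) {a b : WithBot (WithTop (Rees rP rQ))} (hb : b ≠ ⊤) :
    a ≤ b ↔ reesFst a ≤ reesFst b ∧ reesSnd a ≤ reesSnd b ∧
      rQ (reesSnd b) + rho rP (reesFst a) ≤ rho rP (reesFst b) + rQ (reesSnd a) := by
  rcases hat_cases a with rfl | rfl | ⟨z, rfl⟩
  · simp only [bot_le, fst_bot, snd_bot, rho_bot, true_and, true_iff]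
    rcases hat_cases b with rfl | rfl | ⟨w, rfl⟩
    · simp [fst_bot, snd_bot]
    · exact absurd rfl hb
    · rw [fst_coe, snd_coe, rho_coe]; have := w.2; omega
  · rw [hat_top, fst_top, top_le_iff, top_le_iff, fst_eq_top]
    simp [hb]
  · rcases hat_cases b with rfl | rfl | ⟨w, rfl⟩
    · simp [fst_bot, fst_coe]
    · exact absurd rfl hb
    · rw [fst_coe, snd_coe, rho_coe, fst_coe, snd_coe, rho_coe]
      simp only [WithBot.coe_le_coe, WithTop.coe_le_coe]
      change _ ∧ _ ∧ _ ↔ _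
      constructor
      · rintro ⟨h1, h2, h3⟩; exact ⟨h1, h2, by omega⟩
      · rintro ⟨h1, h2, h3⟩; exact ⟨h1, h2, by omega⟩

variable [Finite α] [Finite β]

theorem rho_cov (hrP : IsRankFunction rP) {p q : WithBot (WithTop α)} (h : p ⋖ q) (hq : q ≠ ⊤) :
    rho rP q = rho rP p + 1 := by
  rcases hat_cases q with rfl | rfl | ⟨w, rfl⟩
  · exact absurd h.lt (by simp)
  · exact absurd rfl hq
  · rcases hat_cases p with rfl | rfl | ⟨z, rfl⟩
    · rw [rho_coe, rho_bot, rank_min hrP]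
      intro y hy
      exact h.2 (WithBot.bot_lt_coe (y : WithTop α))
        (WithBot.coe_lt_coe.2 (WithTop.coe_lt_coe.2 hy))
    · exact absurd h.lt (by simp [hat_top])
    · rw [rho_coe, rho_coe]
      rw [WithBot.coe_covBy_coe, WithTop.coe_covBy_coe] at h
      rw [rank_cov hrP h]

theorem rho_mono (hrP : IsRankFunction rP) {p q : WithBot (WithTop α)} (h : p ≤ q) (hq : q ≠ ⊤) :
    rho rP p ≤ rho rP q := by
  rcases hat_cases p with rfl | rfl | ⟨z, rfl⟩
  · exact Nat.zero_le _
  · rw [hat_top, top_le_iff] at h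
    exact absurd h hq
  · rcases hat_cases q with rfl | rfl | ⟨w, rfl⟩
    · simp at h
    · exact absurd rfl hq
    · rw [rho_coe, rho_coe]
      simp only [WithBot.coe_le_coe, WithTop.coe_le_coe] at h
      have := rank_mono hrP _ h
      omega

theorem finite_hat : Finite (WithBot (WithTop α)) := inferInstance

theorem rQ_bot (hrQ : IsRankFunction rQ) : rQ ⊥ = 0 := rank_min hrQ (by simp)

theorem rees_eq_of_fst (hrQ : IsRankFunction rQ) {a b : WithBot (WithTop (Rees rP rQ))}
    (h : a ≤ b) (hf : reesFst a = reesFst b) : a = b := by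
  by_cases hb : b = ⊤
  · subst hb; exact fst_eq_top.1 hf
  · obtain ⟨h1, h2, h3⟩ := (rees_le (rQ_bot hrQ) hb).1 h
    apply rees_ext hf
    rw [hf] at h3
    rcases h2.eq_or_lt with h2 | h2
    · exact h2
    · have := rank_lt hrQ h2
      omega

theorem fst_mono (hrQ : IsRankFunction rQ) {a b : WithBot (WithTop (Rees rP rQ))}
    (h : a ≤ b) : reesFst a ≤ reesFst b := by
  by_cases hb : b = ⊤
  · subst hb; exact le_top
  · exact ((rees_le (rQ_bot hrQ) hb).1 h).1

theorem fst_strict (hrQ : IsRankFunction rQ) {a b : WithBot (WithTop (Rees rP rQ))}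
    (h : a < b) : reesFst a < reesFst b :=
  lt_of_le_of_ne (fst_mono hrQ h.le) fun hf => h.ne (rees_eq_of_fst hrQ h.le hf)

/-- sufficient condition for covering -/
theorem cov_of (hrQ : IsRankFunction rQ) {a b : WithBot (WithTop (Rees rP rQ))}
    (h : a < b) (hf : reesFst a ⋖ reesFst b) : a ⋖ b :=
  ⟨h, fun _ h1 h2 => hf.2 (fst_strict hrQ h1) (fst_strict hrQ h2)⟩

/-- one can move up in the first coordinate keeping the second one -/
theorem exists_flat (hrP : IsRankFunction rP) (hrQ : IsRankFunction rQ)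
    {a : WithBot (WithTop (Rees rP rQ))} {p : WithBot (WithTop α)} (h : reesFst a ⋖ p)
    (hp : p ≠ ⊤) : ∃ z : WithBot (WithTop (Rees rP rQ)), z ≠ ⊤ ∧ a ⋖ z ∧
      reesFst z = p ∧ reesSnd z = reesSnd a := by
  have h0 := rQ_bot hrQ
  have h1 := rho_cov hrP h hp
  have ha : a ≠ ⊤ := by
    rintro rfl
    rw [fst_top] at h
    exact not_top_lt h.lt
  have h2 : rQ (reesSnd a) + 1 ≤ rho rP p := by
    by_cases hb : reesFst a = ⊥
    · rw [snd_of_bot hb, h0]; omega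
    · have := member ha hb
      omega
  obtain ⟨z, hz, hz1, hz2⟩ := exists_mk h2
  have hle : a < z := by
    refine lt_of_le_of_ne ((rees_le h0 hz).2 ⟨?_, ?_, ?_⟩) ?_
    · rw [hz1]; exact h.le
    · rw [hz2]
    · rw [hz1, hz2]; omega
    · rintro rfl; rw [hz1] at h; exact h.ne rfl
  exact ⟨z, hz, cov_of hrQ hle (by rwa [hz1]), hz1, hz2⟩

/-- one can move up in both coordinates, except from the bottom -/
theorem exists_diag (hrP : IsRankFunction rP) (hrQ : IsRankFunction rQ)
    {a : WithBot (WithTop (Rees rP rQ))} {p : WithBot (WithTop α)} {k : β} (h : reesFst a ⋖ p)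
    (hp : p ≠ ⊤) (hk : reesSnd a ⋖ k) (hb : reesFst a ≠ ⊥) :
    ∃ z : WithBot (WithTop (Rees rP rQ)), z ≠ ⊤ ∧ a ⋖ z ∧
      reesFst z = p ∧ reesSnd z = k := by
  have h0 := rQ_bot hrQ
  have h1 := rho_cov hrP h hp
  have h3 := rank_cov hrQ hk
  have ha : a ≠ ⊤ := by
    rintro rfl
    rw [fst_top] at h
    exact not_top_lt h.lt
  have h2 : rQ k + 1 ≤ rho rP p := by
    have := member ha hb
    omega
  obtain ⟨z, hz, hz1, hz2⟩ := exists_mk h2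
  have hle : a < z := by
    refine lt_of_le_of_ne ((rees_le h0 hz).2 ⟨?_, ?_, ?_⟩) ?_
    · rw [hz1]; exact h.le
    · rw [hz2]; exact hk.le
    · rw [hz1, hz2]; omega
    · rintro rfl; rw [hz1] at h; exact h.ne rfl
  exact ⟨z, hz, cov_of hrQ hle (by rwa [hz1]), hz1, hz2⟩

/-- description of the covers -/
theorem rees_cov (hrP : IsRankFunction rP) (hrQ : IsRankFunction rQ)
    {a b : WithBot (WithTop (Rees rP rQ))} (h : a ⋖ b) :
    reesFst a ⋖ reesFst b ∧ (b ≠ ⊤ → CovE (reesSnd a) (reesSnd b)) := by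
  have h0 := rQ_bot hrQ
  have := finite_hat (α := α)
  obtain ⟨p, hp, hpb⟩ := exists_covBy_le_of_lt (fst_strict hrQ h.lt)
  have fin : ∀ z : WithBot (WithTop (Rees rP rQ)), a ⋖ z → z ≤ b → z = b := by
    intro z h1 h2
    rcases h2.eq_or_lt with h2 | h2
    · exact h2
    · exact absurd h2 (h.2 h1.lt)
  by_cases hb : b = ⊤
  · subst hb
    refine ⟨?_, fun h => absurd rfl h⟩
    by_cases hpt : p = ⊤
    · rw [fst_top, ← hpt]; exact hp
    · obtain ⟨z, hz, haz, -, -⟩ := exists_flat hrP hrQ hp hpt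
      exact absurd (fin z haz le_top) hz
  · have hpt : p ≠ ⊤ := by
      rintro rfl
      rw [top_le_iff, fst_eq_top] at hpb
      exact hb hpb
    obtain ⟨l1, l2, l3⟩ := (rees_le h0 hb).1 h.le
    have r1 := rho_cov hrP hp hpt
    have hbt : reesFst b ≠ ⊤ := by rwa [Ne, fst_eq_top]
    have r2 := rho_mono hrP hpb hbt
    by_cases hc : rQ (reesSnd b) + rho rP p ≤ rho rP (reesFst b) + rQ (reesSnd a)
    · obtain ⟨z, hz, haz, hz1, hz2⟩ := exists_flat hrP hrQ hp hpt
      have : z = b := by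
        apply fin z haz
        rw [rees_le h0 hb, hz1, hz2]
        exact ⟨hpb, l2, hc⟩
      subst this
      rw [hz1, hz2]
      exact ⟨hp, fun _ => Or.inl rfl⟩
    · have hlt : reesSnd a < reesSnd b := by
        apply lt_of_le_of_ne l2
        intro he
        rw [he] at hc
        omega
      obtain ⟨k, hk, hkb⟩ := exists_covBy_le_of_lt hlt
      have r3 := rank_cov hrQ hk
      have hab : reesFst a ≠ ⊥ := by
        intro hab
        have h5 := snd_of_bot hab
        have h6 : reesFst b ≠ ⊥ := by
          intro h6
          rw [h6, le_bot_iff] at hpb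
          rw [hpb] at hp
          exact not_lt_bot hp.lt
        have := member hb h6
        rw [hab, rho_bot] at r1
        rw [h5, h0] at hc
        omega
      obtain ⟨z, hz, haz, hz1, hz2⟩ := exists_diag hrP hrQ hp hpt hk hab
      have : z = b := by
        apply fin z haz
        rw [rees_le h0 hb, hz1, hz2]
        exact ⟨hpb, hkb, by omega⟩
      subst this
      rw [hz1, hz2]
      exact ⟨hp, fun _ => Or.inr hk⟩

theorem lex_irrefl' {L : Type*} [PartialOrder L] (u : List L) : ¬ List.Lex (· < ·) u u := by
  induction u with
  | nil => intro h; cases h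
  | cons a u ih =>
    intro h
    cases h with
    | rel h => exact lt_irrefl _ h
    | cons h => exact ih h

theorem rpath_cov_le {X : Type*} [PartialOrder X] {y : X} (l : List X) (x : X)
    (h : RPath (· ⋖ ·) x y l) : x ≤ y := by
  revert x l
  apply rpath_ind
  · exact le_rfl
  · intro x z t h1 _ h2
    exact h1.le.trans h2

theorem len_rho (hrP : IsRankFunction rP) {q : WithBot (WithTop α)} (hq : q ≠ ⊤)
    (C : List (WithBot (WithTop α))) (p : WithBot (WithTop α))
    (h : RPath (· ⋖ ·) p q C) : C.length + rho rP p = rho rP q + 1 := by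
  revert p C
  apply rpath_ind
  · simp; omega
  · intro x z t h1 hp h2
    have hz : z ≠ ⊤ := by
      rintro rfl
      exact hq (top_le_iff.1 (rpath_cov_le _ _ hp))
    have := rho_cov hrP h1 hz
    simp at h2 ⊢
    omega

theorem path_fst (hrP : IsRankFunction rP) (hrQ : IsRankFunction rQ)
    {b : WithBot (WithTop (Rees rP rQ))} (D : List (WithBot (WithTop (Rees rP rQ))))
    (a : WithBot (WithTop (Rees rP rQ))) (h : RPath (· ⋖ ·) a b D) :
    RPath (· ⋖ ·) (reesFst a) (reesFst b) (D.map reesFst) := by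
  revert a D
  apply rpath_ind
  · exact rpath_single _
  · intro x z t h1 hp h2
    exact rpath_cons (rees_cov hrP hrQ h1).1 h2

theorem path_snd (hrP : IsRankFunction rP) (hrQ : IsRankFunction rQ)
    {b : WithBot (WithTop (Rees rP rQ))} (hb : b ≠ ⊤)
    (D : List (WithBot (WithTop (Rees rP rQ))))
    (a : WithBot (WithTop (Rees rP rQ))) (h : RPath (· ⋖ ·) a b D) :
    RPath CovE (reesSnd a) (reesSnd b) (D.map reesSnd) := by
  revert a D
  apply rpath_ind
  · exact rpath_single _
  · intro x z t h1 hp h2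
    have hz : z ≠ ⊤ := by
      rintro rfl
      exact hb (top_le_iff.1 (rpath_cov_le _ _ hp))
    exact rpath_cons ((rees_cov hrP hrQ h1).2 hz) h2

theorem list_ext_rees (C D : List (WithBot (WithTop (Rees rP rQ))))
    (h1 : C.map reesFst = D.map reesFst) (h2 : C.map reesSnd = D.map reesSnd) : C = D := by
  induction C generalizing D with
  | nil => cases D with
    | nil => rfl
    | cons d D => simp at h1
  | cons c C ih =>
    cases D with
    | nil => simp at h1
    | cons d D =>
      simp only [List.map_cons, List.cons.injEq] at h1 h2
      rw [rees_ext h1.1 h2.1, ih D h1.2 h2.2]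

theorem seq_zip {L₁ L₂ : Type*} [PartialOrder L₂]
    (lab₁ : WithBot (WithTop α) → WithBot (WithTop α) → L₁) (lab₂ : β → β → L₂) :
    ∀ D : List (WithBot (WithTop (Rees rP rQ))),
    labelSeq (reesLab rP rQ lab₁ lab₂) D =
      List.zip (labelSeq lab₁ (D.map reesFst)) (labelSeq (labE lab₂) (D.map reesSnd))
  | [] => rfl
  | [a] => rfl
  | a :: b :: D => by
    have := seq_zip lab₁ lab₂ (b :: D)
    simp only [List.map_cons] at this
    simp only [List.map_cons, labelSeq_cons, List.zip_cons_cons, this]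
    rfl

theorem seq_len_eq {L₁ L₂ : Type*} [PartialOrder L₂]
    (lab₁ : WithBot (WithTop α) → WithBot (WithTop α) → L₁) (lab₂ : β → β → L₂)
    (D : List (WithBot (WithTop (Rees rP rQ)))) :
    (labelSeq lab₁ (D.map reesFst)).length =
      (labelSeq (labE lab₂) (D.map reesSnd)).length := by
  simp [labelSeq_length]

/-- lifting a pair of chains, top of the interval proper -/
theorem lift_proper (hrP : IsRankFunction rP) (hrQ : IsRankFunction rQ)
    {b : WithBot (WithTop (Rees rP rQ))} (hb : b ≠ ⊤)
    (C1 : List (WithBot (WithTop α))) (p : WithBot (WithTop α))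
    (h : RPath (· ⋖ ·) p (reesFst b) C1) :
    ∀ (a : WithBot (WithTop (Rees rP rQ))) (C2 : List β), a ≤ b → reesFst a = p →
      RPath (· ⋖ ·) (reesSnd a) (reesSnd b) C2 →
      ∃ D : List (WithBot (WithTop (Rees rP rQ))), RPath (· ⋖ ·) a b D ∧
        D.map reesFst = C1 ∧
        D.map reesSnd = List.replicate (C1.length - C2.length) (reesSnd a) ++ C2 := by
  have h0 := rQ_bot hrQ
  have hrQ' : ∀ k l : β, k ⋖ l → rQ l = rQ k + 1 := fun k l h => rank_cov hrQ h
  have hbt : reesFst b ≠ ⊤ := by rwa [Ne, fst_eq_top]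
  revert p C1
  apply rpath_ind
  · intro a C2 hab hf hC2
    have := rees_eq_of_fst hrQ hab hf
    subst this
    have hl := len_strict hrQ' _ _ hC2
    refine ⟨[a], rpath_single _, rfl, ?_⟩
    rcases rpath_cases hC2 with ⟨rfl, -⟩ | ⟨z, t, rfl, -, -⟩
    · simp
    · simp at hl; omega
  · intro p q t hpq hq ih a C2 hab hf hC2
    have hqt : q ≠ ⊤ := by
      rintro rfl
      exact hbt (top_le_iff.1 (rpath_cov_le _ _ hq))
    obtain ⟨l1, l2, l3⟩ := (rees_le h0 hb).1 hab
    have hl2 := len_strict hrQ' _ _ hC2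
    have hl1 := len_rho hrP hbt _ _ (rpath_cons (R := (· ⋖ ·)) hpq hq)
    have hpq' := rho_cov hrP hpq hqt
    subst hf
    by_cases hc : C2.length < (reesFst a :: q :: t).length
    · obtain ⟨z, hz, haz, hz1, hz2⟩ := exists_flat hrP hrQ hpq hqt
      obtain ⟨D, hD, hD1, hD2⟩ := ih z C2 (by
        rw [rees_le h0 hb, hz1, hz2]
        exact ⟨rpath_cov_le _ _ hq, l2, by omega⟩) hz1 (by rwa [hz2])
      refine ⟨a :: D, rpath_cons haz hD, by simp [hD1], ?_⟩
      have : (reesFst a :: q :: t).length - C2.length = ((q :: t).length - C2.length) + 1 := by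
        simp at hc ⊢; omega
      rw [this, List.replicate_succ, List.map_cons, hD2, hz2]
      rfl
    · have hc' : C2.length = (reesFst a :: q :: t).length := by omega
      rcases rpath_cases hC2 with ⟨rfl, -⟩ | ⟨k, t', rfl, hk, hkt⟩
      · simp at hc'
      · have hab : reesFst a ≠ ⊥ := by
          intro hab
          have h5 := snd_of_bot hab
          have h6 : reesFst b ≠ ⊥ := by
            intro h6
            have := rpath_cov_le _ _ hq
            rw [h6, le_bot_iff] at this
            rw [this] at hpq
            exact not_lt_bot hpq.lt
          have := member hb h6
          rw [hab, rho_bot] at hl1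
          rw [h5, h0] at hl2
          simp at hl1 hl2 hc'
          omega
        obtain ⟨z, hz, haz, hz1, hz2⟩ := exists_diag hrP hrQ hpq hqt hk hab
        have hk' := rank_cov hrQ hk
        obtain ⟨D, hD, hD1, hD2⟩ := ih z (k :: t') (by
          rw [rees_le h0 hb, hz1, hz2]
          exact ⟨rpath_cov_le _ _ hq, rpath_cov_le _ _ hkt, by omega⟩) hz1 (by rwa [hz2])
        refine ⟨a :: D, rpath_cons haz hD, by simp [hD1], ?_⟩
        have e1 : (reesFst a :: q :: t).length - (reesSnd a :: k :: t').length = 0 := by omega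
        have e2 : (q :: t).length - (k :: t').length = 0 := by simp at hc' ⊢; omega
        rw [e2] at hD2
        rw [e1, List.map_cons, hD2]
        rfl

/-- lifting a chain ending in the adjoined top -/
theorem lift_top (hrP : IsRankFunction rP) (hrQ : IsRankFunction rQ) {L₂ : Type*}
    (lab₂ : β → β → L₂)
    (C1 : List (WithBot (WithTop α))) (p : WithBot (WithTop α))
    (h : RPath (· ⋖ ·) p ⊤ C1) :
    ∀ (a : WithBot (WithTop (Rees rP rQ))), reesFst a = p →
      ∃ D : List (WithBot (WithTop (Rees rP rQ))), RPath (· ⋖ ·) a ⊤ D ∧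
        D.map reesFst = C1 ∧
        ∀ s ∈ labelSeq (labE lab₂) (D.map reesSnd), s = ⊥ := by
  revert p C1
  apply rpath_ind
  · intro a ha
    rw [fst_eq_top] at ha
    subst ha
    exact ⟨[⊤], rpath_single _, rfl, by simp [labelSeq]⟩
  · rintro p q t hpq hq ih a rfl
    obtain ⟨z, haz, hz1, hz2⟩ : ∃ z : WithBot (WithTop (Rees rP rQ)), a ⋖ z ∧
        reesFst z = q ∧ labE lab₂ (reesSnd a) (reesSnd z) = ⊥ := by
      by_cases hqt : q = ⊤
      · subst hqt
        refine ⟨⊤, cov_of hrQ (lt_top_iff_ne_top.2 ?_) hpq, rfl, by simp [snd_top, labE]⟩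
        rintro rfl
        exact hpq.ne rfl
      · obtain ⟨z, hz, haz, hz1, hz2⟩ := exists_flat hrP hrQ hpq hqt
        exact ⟨z, haz, hz1, by rw [hz2, labE_self]⟩
    obtain ⟨D, hD, hD1, hD2⟩ := ih z hz1
    refine ⟨a :: D, rpath_cons haz hD, by simp [hD1], ?_⟩
    obtain ⟨t', rfl⟩ := rpath_head hD
    simp only [List.map_cons, labelSeq_cons, List.mem_cons, hz2]
    rintro s (hs | hs)
    · exact hs
    · exact hD2 s hs

/-- flat chains to the top are determined by their first coordinates -/
theorem flat_unique (hrP : IsRankFunction rP) (hrQ : IsRankFunction rQ) {L₂ : Type*}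
    (lab₂ : β → β → L₂)
    (C : List (WithBot (WithTop (Rees rP rQ)))) (a : WithBot (WithTop (Rees rP rQ)))
    (h : RPath (· ⋖ ·) a ⊤ C) :
    ∀ D, RPath (· ⋖ ·) a ⊤ D → D.map reesFst = C.map reesFst →
      (∀ s ∈ labelSeq (labE lab₂) (C.map reesSnd), s = ⊥) →
      (∀ s ∈ labelSeq (labE lab₂) (D.map reesSnd), s = ⊥) → D = C := by
  have step : ∀ x z : WithBot (WithTop (Rees rP rQ)), x ⋖ z → z ≠ ⊤ →
      labE lab₂ (reesSnd x) (reesSnd z) = ⊥ → reesSnd z = reesSnd x := by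
    intro x z hxz hz hl
    rcases (rees_cov hrP hrQ hxz).2 hz with h | h
    · exact h.symm
    · rw [labE_lt _ h.lt] at hl
      simp at hl
  revert a C
  apply rpath_ind
  · intro D hD hf _ _
    rcases rpath_cases hD with ⟨h, -⟩ | ⟨z, t, rfl, -, -⟩
    · exact h
    · simp at hf
  · intro x z t hxz hzt ih D hD hf hC0 hD0
    rcases rpath_cases hD with ⟨rfl, -⟩ | ⟨w, t', rfl, hxw, hwt⟩
    · simp at hf
    · simp only [List.map_cons, labelSeq_cons, List.mem_cons, forall_eq_or_imp,
        List.cons.injEq] at hf hC0 hD0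
      have hwz : w = z := by
        by_cases hz : z = ⊤
        · subst hz
          exact fst_eq_top.1 hf.2.1
        · have hw : w ≠ ⊤ := by
            rintro rfl
            exact hz (fst_eq_top.1 hf.2.1.symm)
          apply rees_ext hf.2.1
          rw [step x z hxz hz hC0.1, step x w hxw hw hD0.1]
      subst hwz
      rw [ih (w :: t') hwt (by simp [hf.2.2]) hC0.2 hD0.2]

/-- increasing chains to the top are flat -/
theorem incr_flat {L₂ : Type*} [PartialOrder L₂] (lab₂ : β → β → L₂)
    (D : List (WithBot (WithTop (Rees rP rQ)))) (a : WithBot (WithTop (Rees rP rQ)))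
    (h : RPath (· ⋖ ·) a ⊤ D) :
    (labelSeq (labE lab₂) (D.map reesSnd)).IsChain (· ≤ ·) →
      (∀ s ∈ labelSeq (labE lab₂) (D.map reesSnd), s = ⊥) := by
  revert a D
  apply rpath_ind
  · intro _; simp [labelSeq]
  · intro x z t hxz hzt ih hi
    simp only [List.map_cons, labelSeq_cons, List.mem_cons, forall_eq_or_imp] at hi ih ⊢
    have h2 := ih hi.tail
    refine ⟨?_, h2⟩
    rcases rpath_cases hzt with ⟨h, hz⟩ | ⟨w, t', h, -, -⟩
    · subst hz
      simp [snd_top, labE]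
    · obtain ⟨-, rfl⟩ := List.cons.inj h
      simp only [List.map_cons, labelSeq_cons, List.mem_cons, forall_eq_or_imp] at hi h2
      rw [List.isChain_cons_cons, h2.1, le_bot_iff] at hi
      exact hi.1

theorem rees_main {L₁ L₂ : Type*} [PartialOrder L₁] [PartialOrder L₂]
    (hrP : IsRankFunction rP) (hrQ : IsRankFunction rQ)
    (lab₁ : WithBot (WithTop α) → WithBot (WithTop α) → L₁)
    (lab₂ : β → β → L₂)
    (hEL : IsELLabeling lab₁) (hsemiEL : IsSemiELLabeling lab₂) :
    IsELLabeling (reesLab rP rQ lab₁ lab₂) := by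
  intro a b hab
  have hrQ' : ∀ k l : β, k ⋖ l → rQ l = rQ k + 1 := fun k l h => rank_cov hrQ h
  obtain ⟨C1, hC1, hi1, hu1, hlex1⟩ := (el_iff _ _ _).1 (hEL _ _ (fst_mono hrQ hab))
  rw [el_iff]
  by_cases hb : b = ⊤
  · subst hb
    obtain ⟨C, hC, hCf, hCs⟩ := lift_top hrP hrQ lab₂ C1 _ hC1 a rfl
    have hiC : (labelSeq (labE lab₂) (C.map reesSnd)).IsChain (· ≤ ·) := by
      rw [List.isChain_iff_getElem]
      intro i hi
      rw [hCs _ (List.getElem_mem _)]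
      exact bot_le
    refine ⟨C, hC, ?_, ?_, ?_⟩
    · rw [seq_zip, zip_chain _ _ (seq_len_eq _ _ _), hCf]
      exact ⟨hi1, hiC⟩
    · intro D hD hiD
      rw [seq_zip, zip_chain _ _ (seq_len_eq _ _ _)] at hiD
      have h1 := hu1 _ (path_fst hrP hrQ _ _ hD) hiD.1
      exact flat_unique hrP hrQ lab₂ C a hC D hD (h1.trans hCf.symm) hCs
        (incr_flat lab₂ _ _ hD hiD.2)
    · intro D hD hne
      rw [seq_zip, seq_zip]
      by_cases hf : D.map reesFst = C1
      · apply zip_lex_bot _ _ _ _ (seq_len_eq _ _ _) (seq_len_eq _ _ _) _ hCs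
        · rintro ⟨-, h2⟩
          exact hne (flat_unique hrP hrQ lab₂ C a hC D hD (hf.trans hCf.symm) hCs (h2 ▸ hCs))
        · left; rw [hf, hCf]
      · have hl := hlex1 _ (path_fst hrP hrQ _ _ hD) hf
        apply zip_lex_bot _ _ _ _ (seq_len_eq _ _ _) (seq_len_eq _ _ _) _ hCs
        · rintro ⟨h1, -⟩
          rw [← hCf, h1] at hl
          exact lex_irrefl' _ hl
        · right; rw [hCf]; exact hl
  · obtain ⟨l1, l2, l3⟩ := (rees_le (rQ_bot hrQ) hb).1 hab
    obtain ⟨m, hm, hmax⟩ := Finite.exists_le_maximal (p := fun _ : β => True) (a := reesSnd b) trivial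
    have hmax' : IsMax m := fun x hx => hmax.2 trivial hx
    obtain ⟨C2, hC2, hi2, hu2, hlex2⟩ := (el_iff _ _ _).1 (hsemiEL m hmax' _ _ l2 hm)
    obtain ⟨C, hC, hCf, hCs⟩ := lift_proper hrP hrQ hb C1 _ hC1 a C2 hab rfl hC2
    have hbt : reesFst b ≠ ⊤ := by rwa [Ne, fst_eq_top]
    have hlen : ∀ D : List (WithBot (WithTop (Rees rP rQ))), RPath (· ⋖ ·) a b D →
        (D.map reesSnd).length = C1.length := by
      intro D hD
      have h1 := len_rho hrP hbt _ _ hC1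
      have h2 := len_rho hrP hbt _ _ (path_fst hrP hrQ _ _ hD)
      simp at h2 ⊢
      omega
    refine ⟨C, hC, ?_, ?_, ?_⟩
    · rw [seq_zip, zip_chain _ _ (seq_len_eq _ _ _), hCf, hCs]
      exact ⟨hi1, canon_incr lab₂ hC2 hi2 _⟩
    · intro D hD hiD
      rw [seq_zip, zip_chain _ _ (seq_len_eq _ _ _)] at hiD
      have h1 := hu1 _ (path_fst hrP hrQ _ _ hD) hiD.1
      have h2 := weak_unique hrQ' lab₂ hC2 hu2 _ _ (path_snd hrP hrQ hb _ _ hD) rfl hiD.2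
      rw [hlen D hD] at h2
      exact list_ext_rees _ _ (h1.trans hCf.symm) (h2.trans hCs.symm)
    · intro D hD hne
      rw [seq_zip, seq_zip]
      have h2 := weak_lex hrQ' lab₂ hC2 hlex2 _ _ (path_snd hrP hrQ hb _ _ hD) rfl
      rw [hlen D hD, ← hCs] at h2
      have h1 : D.map reesFst = C.map reesFst ∨
          List.Lex (· < ·) (labelSeq lab₁ (C.map reesFst)) (labelSeq lab₁ (D.map reesFst)) := by
        by_cases hf : D.map reesFst = C1
        · left; rw [hf, hCf]
        · right; rw [hCf]; exact hlex1 _ (path_fst hrP hrQ _ _ hD) hf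
      apply zip_lex _ _ _ _ (seq_len_eq _ _ _) (seq_len_eq _ _ _)
      · rcases h1 with h1 | h1
        · left; rw [h1]
        · exact Or.inr h1
      · rcases h2 with h2 | h2
        · left; rw [h2]
        · exact Or.inr h2
      · rintro ⟨e1, e2⟩
        rcases h1 with h1 | h1
        · rcases h2 with h2 | h2
          · exact hne (list_ext_rees _ _ h1 h2)
          · rw [e2] at h2
            exact lex_irrefl' _ h2
        · rw [e1] at h1
          exact lex_irrefl' _ h1

end structureOfRees

end ReesProof

/-- Theorem 2.3 of Linusson–Shareshian–Wachs: if `λ₁` is an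
EL-labeling of `P̂₁` and `λ₂` is a semi-EL-labeling of `P₂`, where `P₁`, `P₂` are finite
semipure posets of the same length and `P₂` has a minimum element, then the Rees-product
labeling is an EL-labeling of `(P₁ ∗ P₂)^`. -/
theorem statement_0 {α β L₁ L₂ : Type*} [PartialOrder α] [Fintype α]
    [PartialOrder β] [Fintype β] [OrderBot β] [PartialOrder L₁] [PartialOrder L₂]
    (n : ℕ) (rP : α → ℕ) (rQ : β → ℕ)
    (hrP : IsRankFunction rP) (hrQ : IsRankFunction rQ)
    (hlenP : HasLength α n) (hlenQ : HasLength β n)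
    (lab₁ : WithBot (WithTop α) → WithBot (WithTop α) → L₁)
    (lab₂ : β → β → L₂)
    (hEL : IsELLabeling lab₁) (hsemiEL : IsSemiELLabeling lab₂) :
    IsELLabeling (reesLab rP rQ lab₁ lab₂) := by
  exact rees_main hrP hrQ lab₁ lab₂ hEL hsemiEL
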